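/- Fix natural numbers K ≥ 1 and M ≥ K + 1. Let μ_{M×K} be the law of an M × K random matrix G whose entries are i.i.d. standard complex Gaussian. Then for μ_{M×K}-almost every G the K × K Gram matrix Gᴴ G is invertible, and for every index k ∈ {1, …, K} the expectation of the k-th diagonal entry of (Gᴴ G)⁻¹ equals 1/(M − K); that is, ∫ ((Gᴴ G)⁻¹)_{kk} dμ_{M×K}(G) = 1/(M − K). -/

import Mathlib

open MeasureTheory ProbabilityTheory Matrix

instance matrixMeasurableSpace {m n α : Type*} [MeasurableSpace α] :
    MeasurableSpace (Matrix m n α) :=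
  inferInstanceAs (MeasurableSpace (m → n → α))

/-- The standard complex Gaussian probability measure on `ℂ`: pushforward of the
product of two real Gaussians `N(0, 1/2)` under `(x, y) ↦ x + I * y`. -/
noncomputable def stdComplexGaussian : Measure ℂ :=
  Measure.map (fun p : ℝ × ℝ => (p.1 : ℂ) + Complex.I * (p.2 : ℂ))
    ((gaussianReal 0 (1/2)).prod (gaussianReal 0 (1/2)))

/-- `μ_{M×K}`: the law of an `M × K` matrix with i.i.d. standard complex Gaussian
entries, i.e. the product measure over `Fin M × Fin K` of copies of `γ_ℂ`, viewed
as a measure on `M × K` complex matrices. -/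
noncomputable def stdComplexGaussianMatrix (M K : ℕ) : Measure (Matrix (Fin M) (Fin K) ℂ) :=
  Measure.map (fun f => Matrix.of fun i j => f (i, j))
    (Measure.pi fun _ : Fin M × Fin K => stdComplexGaussian)


lemma measurable_toC : Measurable (fun p : ℝ × ℝ => (p.1 : ℂ) + Complex.I * (p.2 : ℂ)) := by
  fun_prop

instance instProbStd : IsProbabilityMeasure stdComplexGaussian := by
  unfold stdComplexGaussian
  exact Measure.isProbabilityMeasure_map measurable_toC.aemeasurable

lemma charFun_std (z : ℂ) : charFun stdComplexGaussian z = Complex.exp (-((‖z‖ ^ 2 / 4 : ℝ) : ℂ)) := by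
  rw [charFun, stdComplexGaussian, integral_map measurable_toC.aemeasurable (by fun_prop)]
  have h : ∀ p : ℝ × ℝ, Complex.exp ((inner ℝ ((p.1 : ℂ) + Complex.I * (p.2 : ℂ)) z : ℝ) * Complex.I)
      = Complex.exp ((z.re : ℂ) * p.1 * Complex.I) * Complex.exp ((z.im : ℂ) * p.2 * Complex.I) := by
    intro p
    rw [← Complex.exp_add]
    congr 1
    simp
    ring
  simp_rw [h]
  rw [integral_prod_mul (fun x : ℝ => Complex.exp ((z.re : ℂ) * x * Complex.I))
    (fun x : ℝ => Complex.exp ((z.im : ℂ) * x * Complex.I)), ← charFun_apply_real,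
    ← charFun_apply_real, charFun_gaussianReal, charFun_gaussianReal, ← Complex.exp_add]
  congr 1
  rw [Complex.sq_norm, Complex.normSq_apply]
  push_cast
  simp
  ring

lemma map_mulVec {n M : ℕ} (A : Matrix (Fin n) (Fin M) ℂ) (hA : A * Aᴴ = 1) :
    (Measure.pi fun _ : Fin M => stdComplexGaussian).map (fun v => A *ᵥ v) = Measure.pi fun _ : Fin n => stdComplexGaussian := by
  have hm : Measurable (fun v : Fin M → ℂ => A *ᵥ v) := by
    apply Continuous.measurable; fun_prop
  have := Measure.isProbabilityMeasure_map (μ := Measure.pi fun _ : Fin M => stdComplexGaussian) hm.aemeasurable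
  rw [← charFun_eq_pi_iff]
  intro t
  have key : charFun (((Measure.pi fun _ : Fin M => stdComplexGaussian).map (fun v => A *ᵥ v)).map
        (WithLp.toLp 2)) t
      = charFun ((Measure.pi fun _ : Fin M => stdComplexGaussian).map (WithLp.toLp 2))
        (WithLp.toLp 2 (Aᴴ *ᵥ t.ofLp)) := by
    rw [Measure.map_map (by fun_prop) hm, charFun, charFun, integral_map (by fun_prop) (by fun_prop),
      integral_map (by fun_prop) (by fun_prop)]
    congr 1; ext v; congr 3
    simp only [PiLp.inner_apply, Function.comp, Complex.inner, ← Complex.re_sum]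
    congr 1
    change t.ofLp ⬝ᵥ star (A *ᵥ v) = (Aᴴ *ᵥ t.ofLp) ⬝ᵥ star v
    rw [star_mulVec, dotProduct_comm, ← dotProduct_mulVec, dotProduct_comm]
  have hn : ∑ i, ‖(Aᴴ *ᵥ t.ofLp) i‖ ^ 2 = ∑ i, ‖t i‖ ^ 2 := by
    have h1 : ∀ {k : ℕ} (w : Fin k → ℂ), ((∑ i, ‖w i‖ ^ 2 : ℝ) : ℂ) = star w ⬝ᵥ w := by
      intro k w
      simp [dotProduct, Complex.conj_mul']
    have : ((∑ i, ‖(Aᴴ *ᵥ t.ofLp) i‖ ^ 2 : ℝ) : ℂ) = ((∑ i, ‖t i‖ ^ 2 : ℝ) : ℂ) := by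
      rw [h1, h1 t.ofLp, star_mulVec, conjTranspose_conjTranspose, ← dotProduct_mulVec,
        mulVec_mulVec, hA, one_mulVec]
    exact_mod_cast this
  rw [key, charFun_pi]
  simp_rw [charFun_std, ← Complex.exp_sum]
  congr 1
  simp only [Finset.sum_neg_distrib, ← Complex.ofReal_sum, ← Finset.sum_div]
  rw [hn]

lemma integral_exp_gauss (t : ℝ) (ht : 0 ≤ t) :
    ∫ x, Real.exp (-t * x ^ 2) ∂(gaussianReal 0 (1/2)) = (√(1 + t))⁻¹ := by
  rw [integral_gaussianReal_eq_integral_smul (by norm_num)]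
  have : ∀ x : ℝ, gaussianPDFReal 0 (1/2) x • Real.exp (-t * x ^ 2)
      = (√Real.pi)⁻¹ * Real.exp (-(1 + t) * x ^ 2) := by
    intro x
    rw [gaussianPDFReal, smul_eq_mul, mul_assoc, ← Real.exp_add]
    congr 2
    · have h2 : (2 : ℝ) * Real.pi * ((1 / 2 : NNReal) : ℝ) = Real.pi := by
        push_cast
        ring
      rw [h2]
    · push_cast
      ring
  simp_rw [this]
  rw [integral_const_mul, integral_gaussian, Real.sqrt_div Real.pi_pos.le]
  have : √Real.pi ≠ 0 := by positivity
  field_simp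

lemma integral_exp_std (t : ℝ) (ht : 0 ≤ t) :
    ∫ z, Real.exp (-t * ‖z‖ ^ 2) ∂stdComplexGaussian = (1 + t)⁻¹ := by
  rw [stdComplexGaussian, integral_map measurable_toC.aemeasurable (by fun_prop)]
  have h : ∀ p : ℝ × ℝ, Real.exp (-t * ‖(p.1 : ℂ) + Complex.I * (p.2 : ℂ)‖ ^ 2)
      = Real.exp (-t * p.1 ^ 2) * Real.exp (-t * p.2 ^ 2) := by
    intro p
    rw [← Real.exp_add, Complex.sq_norm, Complex.normSq_apply]
    congr 1
    simp
    ring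
  simp_rw [h]
  rw [integral_prod_mul (fun x : ℝ => Real.exp (-t * x ^ 2))
    (fun x : ℝ => Real.exp (-t * x ^ 2)), integral_exp_gauss t ht, ← mul_inv,
    Real.mul_self_sqrt (by linarith)]

lemma lintegral_exp_pi {n : ℕ} (t : ℝ) (ht : 0 ≤ t) :
    ∫⁻ v, ENNReal.ofReal (Real.exp (-t * ∑ i, ‖v i‖ ^ 2)) ∂(Measure.pi fun _ : Fin n => stdComplexGaussian)
      = ENNReal.ofReal (((1 + t) ^ n)⁻¹) := by
  rw [← ofReal_integral_eq_lintegral_ofReal]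
  · congr 1
    simp_rw [Finset.mul_sum, Real.exp_sum]
    rw [integral_fintype_prod_eq_pow (μ := stdComplexGaussian) (f := fun z : ℂ => Real.exp (-t * ‖z‖ ^ 2)), integral_exp_std t ht]
    simp
  · refine Integrable.of_bound (C := 1) (Continuous.aestronglyMeasurable (by fun_prop)) (Filter.Eventually.of_forall fun v => ?_)
    rw [Real.norm_eq_abs, Real.abs_exp, Real.exp_le_one_iff]
    have : 0 ≤ ∑ i, ‖v i‖ ^ 2 := by positivity
    nlinarith
  · exact Filter.Eventually.of_forall fun v => (Real.exp_pos _).le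

instance instNullStd : NullSingletonClass stdComplexGaussian := by
  constructor
  intro z
  have : NullSingletonClass (gaussianReal 0 (1/2)) := nullSingletonClass_gaussianReal (by norm_num)
  rw [stdComplexGaussian, Measure.map_apply measurable_toC (measurableSet_singleton z)]
  refine measure_mono_null (t := {z.re} ×ˢ Set.univ) ?_ ?_
  · rintro p hp
    have := congrArg Complex.re (Set.mem_singleton_iff.1 hp)
    simp at this
    simp [this]
  · rw [Measure.prod_prod, measure_singleton, zero_mul]

lemma ae_pi_ne_zero {n : ℕ} (hn : 0 < n) :
    ∀ᵐ v ∂(Measure.pi fun _ : Fin n => stdComplexGaussian), v ≠ 0 := by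
  have : Nonempty (Fin n) := ⟨⟨0, hn⟩⟩
  rw [ae_iff]
  simp [measure_singleton]

lemma lintegral_exp_Ioi {s : ℝ} (hs : 0 < s) :
    ∫⁻ t in Set.Ioi (0:ℝ), ENNReal.ofReal (Real.exp (-t * s)) = ENNReal.ofReal s⁻¹ := by
  have h := integral_exp_mul_Ioi (a := -s) (by linarith) 0
  have hi := integrableOn_exp_mul_Ioi (a := -s) (by linarith) 0
  have e : ∀ t : ℝ, -t * s = -s * t := fun t => by ring
  simp_rw [e]
  rw [← ofReal_integral_eq_lintegral_ofReal hi
    (Filter.Eventually.of_forall fun v => (Real.exp_pos _).le), h]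
  simp

lemma lintegral_pow_Ioi (m : ℕ) (hm : 0 < m) :
    ∫⁻ t in Set.Ioi (0:ℝ), ENNReal.ofReal (((1 + t) ^ (m + 1))⁻¹) = ENNReal.ofReal ((m : ℝ)⁻¹) := by
  have hm' : (m : ℝ) ≠ 0 := by positivity
  have hd : ∀ x ∈ Set.Ici (0:ℝ), HasDerivAt (fun t : ℝ => -(m : ℝ)⁻¹ * ((1 + t) ^ m)⁻¹)
      (((1 + x) ^ (m + 1))⁻¹) x := by
    intro x hx
    have hx' : (1 + x) ≠ 0 := by
      have : 0 ≤ x := hx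
      positivity
    have := ((((hasDerivAt_id x).const_add 1).pow m).inv (pow_ne_zero m hx')).const_mul (-(m : ℝ)⁻¹)
    have e : ((1 + x) ^ (m + 1))⁻¹
        = -(m : ℝ)⁻¹ * (-(m * (1 + x) ^ (m - 1) * 1) / ((1 + x) ^ m) ^ 2) := by
      obtain ⟨k, rfl⟩ : ∃ k, m = k + 1 := ⟨m - 1, by omega⟩
      rw [Nat.add_sub_cancel]
      field_simp
      ring
    rw [e]
    exact this
  have hpos : ∀ x ∈ Set.Ioi (0:ℝ), 0 ≤ ((1 + x) ^ (m + 1))⁻¹ := by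
    intro x hx
    have : 0 < x := hx
    positivity
  have ht : Filter.Tendsto (fun t : ℝ => -(m : ℝ)⁻¹ * ((1 + t) ^ m)⁻¹) Filter.atTop (nhds 0) := by
    rw [← mul_zero (-(m : ℝ)⁻¹)]
    apply Filter.Tendsto.const_mul
    apply Filter.Tendsto.inv_tendsto_atTop
    exact (Filter.tendsto_pow_atTop hm.ne').comp (Filter.tendsto_atTop_add_const_left _ _ Filter.tendsto_id)
  have hi := integrableOn_Ioi_deriv_of_nonneg' hd hpos ht
  rw [← ofReal_integral_eq_lintegral_ofReal hi
    ((ae_restrict_iff' measurableSet_Ioi).2 (Filter.Eventually.of_forall hpos)),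
    integral_Ioi_of_hasDerivAt_of_nonneg' hd hpos ht]
  simp

lemma lintegral_inv_normSq (m : ℕ) (hm : 0 < m) :
    ∫⁻ v, ENNReal.ofReal ((∑ i, ‖v i‖ ^ 2)⁻¹) ∂(Measure.pi fun _ : Fin (m + 1) => stdComplexGaussian)
      = ENNReal.ofReal ((m : ℝ)⁻¹) := by
  have h1 : ∀ᵐ v ∂(Measure.pi fun _ : Fin (m + 1) => stdComplexGaussian), ENNReal.ofReal ((∑ i, ‖v i‖ ^ 2)⁻¹)
      = ∫⁻ t in Set.Ioi (0:ℝ), ENNReal.ofReal (Real.exp (-t * ∑ i, ‖v i‖ ^ 2)) := by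
    filter_upwards [ae_pi_ne_zero (Nat.succ_pos m)] with v hv
    rw [lintegral_exp_Ioi]
    obtain ⟨i, hi⟩ := Function.ne_iff.1 hv
    refine Finset.sum_pos' (fun i _ => by positivity) ⟨i, Finset.mem_univ _, ?_⟩
    have : 0 < ‖v i‖ := norm_pos_iff.2 hi
    positivity
  rw [lintegral_congr_ae h1, lintegral_lintegral_swap (by fun_prop), ← lintegral_pow_Ioi m hm]
  refine setLIntegral_congr_fun measurableSet_Ioi fun t ht => ?_
  exact lintegral_exp_pi t (le_of_lt ht)

lemma exists_proj {M K : ℕ} (H : Fin K → (Fin M → ℂ)) :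
    ∃ (n : ℕ) (A : Matrix (Fin n) (Fin M) ℂ), A * Aᴴ = 1 ∧ (∀ j, A *ᵥ H j = 0) ∧
      (∀ u, (∀ j, star (H j) ⬝ᵥ u = 0) → Aᴴ *ᵥ (A *ᵥ u) = u) ∧
      M ≤ n + K ∧ (LinearIndependent ℂ H → n + K = M) := by
  let E := EuclideanSpace ℂ (Fin M)
  let H' : Fin K → E := fun j => WithLp.toLp 2 (H j)
  let S : Submodule ℂ E := Submodule.span ℂ (Set.range H')
  let b := stdOrthonormalBasis ℂ Sᗮ
  have hdim : Module.finrank ℂ S + Module.finrank ℂ Sᗮ = M := by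
    rw [Submodule.finrank_add_finrank_orthogonal]; simp [E]
  have hinner : ∀ (x : E) (y : E), inner ℂ x y = star x.ofLp ⬝ᵥ y.ofLp := by
    intro x y
    rw [EuclideanSpace.inner_eq_star_dotProduct, dotProduct_comm]
  let A : Matrix (Fin (Module.finrank ℂ Sᗮ)) (Fin M) ℂ := of fun i m => star ((b i : E) m)
  have hA : ∀ (u : Fin M → ℂ) i, (A *ᵥ u) i = inner ℂ (b i : E) (WithLp.toLp 2 u) := by
    intro u i
    rw [hinner]; rfl
  refine ⟨Module.finrank ℂ Sᗮ, A, ?_, ?_, ?_, ?_, ?_⟩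
  · ext i j
    have h1 : (A * Aᴴ) i j = inner ℂ (b i : E) (b j : E) := by
      rw [hinner, mul_apply]
      simp [A, dotProduct]
    have h2 := orthonormal_iff_ite.1 b.orthonormal i j
    rw [h1, ← Submodule.coe_inner, h2, one_apply]
  · intro j
    ext i
    rw [hA]
    exact Submodule.inner_left_of_mem_orthogonal (K := S) (Submodule.subset_span ⟨j, rfl⟩) (b i).2
  · intro u hu
    have huS : (WithLp.toLp 2 u : E) ∈ Sᗮ := by
      rw [Submodule.mem_orthogonal]
      intro v hv
      induction hv using Submodule.span_induction with
      | mem x hx => obtain ⟨j, rfl⟩ := hx; rw [hinner]; exact hu j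
      | zero => simp
      | add x y _ _ hx hy => rw [inner_add_left, hx, hy, add_zero]
      | smul a x _ hx => rw [inner_smul_left, hx, mul_zero]
    have h := b.sum_repr' ⟨_, huS⟩
    have h' := congrArg (fun w : Sᗮ => (w : E).ofLp) h
    ext m
    have h'' := congrFun h' m
    simp only [Submodule.coe_inner] at h''
    rw [← h'']
    have h3 : (Aᴴ *ᵥ (A *ᵥ u)) m = ∑ i, inner ℂ (b i : E) (WithLp.toLp 2 u) * (b i : E) m := by
      rw [mulVec, dotProduct]
      refine Finset.sum_congr rfl fun i _ => ?_
      rw [hA, mul_comm]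
      simp [A]
    rw [h3, Submodule.coe_sum, WithLp.ofLp_sum, Finset.sum_apply]
    rfl
  · have : Module.finrank ℂ S ≤ K := by
      simpa [Set.finrank, S] using finrank_range_le_card (R := ℂ) H'
    omega
  · intro hH
    have hH' : LinearIndependent ℂ H' :=
      hH.map' (WithLp.linearEquiv 2 ℂ (Fin M → ℂ)).symm.toLinearMap (LinearEquiv.ker _)
    have : Module.finrank ℂ S = K := by
      simpa using finrank_span_eq_card hH'
    omega

lemma not_mem_span_of {M K n : ℕ} {H : Fin K → (Fin M → ℂ)} {A : Matrix (Fin n) (Fin M) ℂ}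
    (hA : ∀ j, A *ᵥ H j = 0) {g : Fin M → ℂ} (hg : A *ᵥ g ≠ 0) :
    g ∉ Submodule.span ℂ (Set.range H) := by
  intro h
  apply hg
  have : Submodule.span ℂ (Set.range H) ≤ LinearMap.ker A.mulVecLin := by
    rw [Submodule.span_le]
    rintro _ ⟨j, rfl⟩
    exact hA j
  exact this h

/-- matrix from columns -/
def ofCols {M K : ℕ} (c : Fin K → (Fin M → ℂ)) : Matrix (Fin M) (Fin K) ℂ := of fun i j => c j i

open scoped ComplexOrder in
lemma isUnit_iff {M K : ℕ} (c : Fin K → (Fin M → ℂ)) :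
    IsUnit ((ofCols c)ᴴ * ofCols c) ↔ LinearIndependent ℂ c := by
  rw [← mulVec_injective_iff_isUnit]
  have : LinearIndependent ℂ c ↔ Function.Injective (ofCols c).mulVec := by
    rw [mulVec_injective_iff]; rfl
  rw [this]
  have h1 : ∀ (k l : ℕ) (B : Matrix (Fin k) (Fin l) ℂ), Function.Injective B.mulVec ↔ ∀ v, B *ᵥ v = 0 → v = 0 :=
    fun k l B => injective_iff_map_eq_zero B.mulVecLin
  rw [h1, h1]
  exact forall_congr' fun v => by rw [conjTranspose_mul_self_mulVec_eq_zero]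

lemma inv_diag {M K n : ℕ} {H : Fin K → (Fin M → ℂ)} {A : Matrix (Fin n) (Fin M) ℂ}
    (hA : ∀ j, A *ᵥ H j = 0)
    (hA' : ∀ u, (∀ j, star (H j) ⬝ᵥ u = 0) → Aᴴ *ᵥ (A *ᵥ u) = u)
    (k : Fin (K + 1)) (g : Fin M → ℂ)
    (hu : IsUnit ((ofCols (k.insertNth g H : Fin (K + 1) → Fin M → ℂ))ᴴ * ofCols (k.insertNth g H : Fin (K + 1) → Fin M → ℂ))) :
    ((ofCols (k.insertNth g H : Fin (K + 1) → Fin M → ℂ))ᴴ * ofCols (k.insertNth g H : Fin (K + 1) → Fin M → ℂ))⁻¹ k k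
      = (((∑ i, ‖(A *ᵥ g) i‖ ^ 2)⁻¹ : ℝ) : ℂ) := by
  set G := ofCols (k.insertNth g H : Fin (K + 1) → Fin M → ℂ) with hG
  set B := Gᴴ * G with hB
  have hdet : IsUnit B.det := (isUnit_iff_isUnit_det B).1 hu
  set x : Fin (K + 1) → ℂ := B⁻¹ *ᵥ Pi.single k 1 with hx
  have hxk : x k = B⁻¹ k k := by simp [hx]
  have hBx : Gᴴ *ᵥ (G *ᵥ x) = Pi.single k 1 := by
    rw [mulVec_mulVec, ← hB, hx, mulVec_mulVec, mul_nonsing_inv _ hdet, one_mulVec]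
  set u := G *ᵥ x with hu_def
  have hcol : ∀ j, star ((k.insertNth g H : Fin (K + 1) → Fin M → ℂ) j) ⬝ᵥ u = (Pi.single k 1 : Fin (K + 1) → ℂ) j := by
    intro j
    rw [← hBx]; rfl
  have hAu : Aᴴ *ᵥ (A *ᵥ u) = u := by
    apply hA'
    intro j
    have := hcol (k.succAbove j)
    simpa using this
  have husum : u = x k • g + ∑ j, x (k.succAbove j) • H j := by
    rw [hu_def, mulVec_eq_sum, Fin.sum_univ_succAbove _ k]
    congr 1
    · ext i; simp [hG, ofCols, mul_comm]
    · refine Finset.sum_congr rfl fun j _ => ?_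
      ext i; simp [hG, ofCols, mul_comm]
  have hAu2 : A *ᵥ u = x k • (A *ᵥ g) := by
    rw [husum, mulVec_add, mulVec_smul, mulVec_sum]
    simp [mulVec_smul, hA]
  have h1 : ∀ {k : ℕ} (w : Fin k → ℂ), ((∑ i, ‖w i‖ ^ 2 : ℝ) : ℂ) = star w ⬝ᵥ w := by
    intro k w
    simp [dotProduct, Complex.conj_mul']
  have huu : star u ⬝ᵥ u = star (x k) := by
    nth_rewrite 1 [hu_def]
    rw [star_mulVec, ← dotProduct_mulVec, hBx]
    simp
  have huu2 : star u ⬝ᵥ u = star (x k) * x k * (star (A *ᵥ g) ⬝ᵥ (A *ᵥ g)) := by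
    nth_rewrite 2 [← hAu]
    rw [dotProduct_mulVec, ← star_mulVec, hAu2]
    simp only [star_smul, smul_dotProduct, dotProduct_smul, smul_eq_mul]
    ring
  have hne : x k ≠ 0 := by
    intro h0
    have : u = 0 := by
      rw [← hAu, hAu2, h0]; simp
    have h2 := hcol k
    rw [this] at h2
    simp at h2
  rw [huu2, mul_assoc] at huu
  have h3 : x k * (star (A *ᵥ g) ⬝ᵥ (A *ᵥ g)) = 1 := by
    have : star (x k) ≠ 0 := star_ne_zero.2 hne
    exact mul_left_cancel₀ this (by rw [huu, mul_one])
  rw [← hxk, Complex.ofReal_inv, h1]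
  exact eq_inv_of_mul_eq_one_left h3

lemma continuous_ofCols {M K : ℕ} : Continuous (ofCols : (Fin K → (Fin M → ℂ)) → _) := by
  unfold ofCols
  fun_prop

lemma measurableSet_li {M K : ℕ} : MeasurableSet {c : Fin K → (Fin M → ℂ) | LinearIndependent ℂ c} := by
  have : {c : Fin K → (Fin M → ℂ) | LinearIndependent ℂ c}
      = (fun c => ((ofCols c)ᴴ * ofCols c).det) ⁻¹' {0}ᶜ := by
    ext c
    rw [Set.mem_ofPred_eq, ← isUnit_iff, isUnit_iff_isUnit_det, isUnit_iff_ne_zero]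
    rfl
  rw [this]
  have hc := @continuous_ofCols M K
  have h1 : Measurable fun c : Fin K → (Fin M → ℂ) => ((ofCols c)ᴴ * ofCols c).det :=
    Continuous.measurable (by fun_prop)
  exact h1 (measurableSet_singleton 0).compl

lemma measurable_inv_diag {M K : ℕ} (k : Fin K) :
    Measurable fun c : Fin K → (Fin M → ℂ) => ((ofCols c)ᴴ * ofCols c)⁻¹ k k := by
  have hc := @continuous_ofCols M K
  have h1 : Measurable fun c : Fin K → (Fin M → ℂ) => ((ofCols c)ᴴ * ofCols c).det :=
    Continuous.measurable (by fun_prop)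
  have h2 : Measurable fun c : Fin K → (Fin M → ℂ) => ((ofCols c)ᴴ * ofCols c).adjugate k k :=
    Continuous.measurable (Continuous.matrix_elem (Continuous.matrix_adjugate (by fun_prop)) k k)
  have : ∀ c : Fin K → (Fin M → ℂ), ((ofCols c)ᴴ * ofCols c)⁻¹ k k
      = ((ofCols c)ᴴ * ofCols c).det⁻¹ * ((ofCols c)ᴴ * ofCols c).adjugate k k := by
    intro c
    rw [inv_def, Matrix.smul_apply, Ring.inverse_eq_inv', smul_eq_mul]
  simp_rw [this]
  exact h1.inv.mul h2

/-- law of one column -/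
noncomputable abbrev colLaw (M : ℕ) : Measure (Fin M → ℂ) := Measure.pi fun _ : Fin M => stdComplexGaussian

lemma matrix_eq (M K : ℕ) : stdComplexGaussianMatrix M K
    = (Measure.pi fun _ : Fin K => colLaw M).map ofCols := by
  have h : Measure.pi (fun _ : Fin M × Fin K => stdComplexGaussian)
      = (Measure.pi fun _ : Fin K => colLaw M).map (fun c p => c p.2 p.1) := by
    refine Measure.pi_eq fun s hs => ?_
    have hm : Measurable (fun (c : Fin K → Fin M → ℂ) (p : Fin M × Fin K) => c p.2 p.1) :=
      Continuous.measurable (by fun_prop)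
    rw [Measure.map_apply hm (MeasurableSet.univ_pi hs)]
    have : (fun (c : Fin K → Fin M → ℂ) (p : Fin M × Fin K) => c p.2 p.1) ⁻¹' (Set.univ.pi s)
        = Set.univ.pi fun j => Set.univ.pi fun i => s (i, j) := by
      ext c
      simp only [Set.mem_preimage, Set.mem_univ_pi, Prod.forall]
      exact forall_comm
    rw [this, Measure.pi_pi]
    simp_rw [Measure.pi_pi]
    rw [Fintype.prod_prod_type_right]
  rw [stdComplexGaussianMatrix, h, Measure.map_map]
  · rfl
  · exact measurable_pi_lambda _ fun i => measurable_pi_lambda _ fun j => measurable_pi_apply _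
  · exact Continuous.measurable (by fun_prop)

lemma mp_insertNth {M K : ℕ} (k : Fin (K + 1)) :
    MeasurePreserving (fun p : (Fin M → ℂ) × (Fin K → Fin M → ℂ) =>
        (k.insertNth p.1 p.2 : Fin (K + 1) → Fin M → ℂ))
      ((colLaw M).prod (Measure.pi fun _ : Fin K => colLaw M))
      (Measure.pi fun _ : Fin (K + 1) => colLaw M) :=
  (measurePreserving_piFinSuccAbove (fun _ : Fin (K + 1) => colLaw M) k).symm

lemma ae_li {M : ℕ} : ∀ K : ℕ, K ≤ M →
    ∀ᵐ c ∂(Measure.pi fun _ : Fin K => colLaw M), LinearIndependent ℂ c := by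
  intro K
  induction K with
  | zero => exact fun _ => Filter.Eventually.of_forall fun c => linearIndependent_empty_type
  | succ K ih =>
    intro hK
    rw [← (mp_insertNth (M := M) (0 : Fin (K + 1))).map_eq,
      ae_map_iff (mp_insertNth 0).measurable.aemeasurable measurableSet_li]
    have hms : MeasurableSet {p : (Fin M → ℂ) × (Fin K → Fin M → ℂ) |
        LinearIndependent ℂ ((0 : Fin (K + 1)).insertNth p.1 p.2 : Fin (K + 1) → Fin M → ℂ)} :=
      (mp_insertNth 0).measurable measurableSet_li
    rw [Measure.ae_prod_iff_ae_ae hms, Measure.ae_ae_comm hms]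
    filter_upwards [ih (by omega)] with H hH
    obtain ⟨n, A, hA1, hA2, hA3, hA4, hA5⟩ := exists_proj H
    have h0 := ae_pi_ne_zero (n := n) (by omega)
    rw [← map_mulVec A hA1] at h0
    have h1 := ae_of_ae_map (Continuous.aemeasurable (by fun_prop)) h0
    filter_upwards [h1] with g hg
    rw [Fin.insertNth_zero']
    exact linearIndependent_finCons.2 ⟨hH, not_mem_span_of hA2 hg⟩

lemma lintegral_main {M K : ℕ} (hK : K + 2 ≤ M) (k : Fin (K + 1)) :
    ∫⁻ c, ENNReal.ofReal (((ofCols c)ᴴ * ofCols c)⁻¹ k k).re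
      ∂(Measure.pi fun _ : Fin (K + 1) => colLaw M)
      = ENNReal.ofReal (((M - (K + 1) : ℕ) : ℝ)⁻¹) := by
  have hmeas : Measurable fun c : Fin (K + 1) → (Fin M → ℂ) =>
      ENNReal.ofReal (((ofCols c)ᴴ * ofCols c)⁻¹ k k).re := (Complex.measurable_re.comp (measurable_inv_diag (M := M) k)).ennreal_ofReal
  rw [← (mp_insertNth (M := M) k).lintegral_comp hmeas]
  have hcomp := hmeas.comp (mp_insertNth (M := M) k).measurable
  refine (lintegral_prod_symm _ hcomp.aemeasurable).trans ?_
  have hli := ae_li (M := M) (K + 1) (by omega)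
  rw [← (mp_insertNth (M := M) k).map_eq,
      ae_map_iff (mp_insertNth k).measurable.aemeasurable measurableSet_li] at hli
  have hms : MeasurableSet {p : (Fin M → ℂ) × (Fin K → Fin M → ℂ) |
      LinearIndependent ℂ (k.insertNth p.1 p.2 : Fin (K + 1) → Fin M → ℂ)} :=
    (mp_insertNth k).measurable measurableSet_li
  rw [Measure.ae_prod_iff_ae_ae hms, Measure.ae_ae_comm hms] at hli
  have key : ∀ᵐ H ∂(Measure.pi fun _ : Fin K => colLaw M),
      ∫⁻ g, ENNReal.ofReal (((ofCols (k.insertNth g H : Fin (K + 1) → Fin M → ℂ))ᴴ *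
        ofCols (k.insertNth g H : Fin (K + 1) → Fin M → ℂ))⁻¹ k k).re ∂(colLaw M)
      = ENNReal.ofReal (((M - (K + 1) : ℕ) : ℝ)⁻¹) := by
    filter_upwards [ae_li (M := M) K (by omega), hli] with H hH hgH
    obtain ⟨n, A, hA1, hA2, hA3, hA4, hA5⟩ := exists_proj H
    have hn : n = (M - (K + 1)) + 1 := by have := hA5 hH; omega
    subst hn
    rw [← lintegral_inv_normSq (M - (K + 1)) (by omega), ← map_mulVec A hA1, lintegral_map]
    · refine lintegral_congr_ae ?_
      filter_upwards [hgH] with g hg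
      rw [inv_diag hA2 hA3 k g ((isUnit_iff _).2 hg), Complex.ofReal_re]
    · fun_prop
    · exact Continuous.measurable (by fun_prop)
  refine (lintegral_congr_ae key).trans ?_
  simp

open scoped ComplexOrder in
lemma diag_re {M K : ℕ} (k : Fin K) (c : Fin K → (Fin M → ℂ)) :
    0 ≤ (((ofCols c)ᴴ * ofCols c)⁻¹ k k).re ∧
      (((ofCols c)ᴴ * ofCols c)⁻¹ k k).im = 0 := by
  have h : 0 ≤ ((ofCols c)ᴴ * ofCols c)⁻¹ k k :=
    (posSemidef_conjTranspose_mul_self (ofCols c)).inv.diag_nonneg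
  exact ⟨(Complex.nonneg_iff.1 h).1, (Complex.nonneg_iff.1 h).2.symm⟩

/-- for `K ≥ 1` and `M ≥ K + 1`, the Gram matrix `Gᴴ G` of an
`M × K` i.i.d. standard complex Gaussian matrix `G` is almost surely invertible,
and `𝔼 [ ((Gᴴ G)⁻¹)_{kk} ] = 1 / (M - K)` for every `k`. -/
theorem expectation_inv_gram_diag (K M : ℕ) (hK : 1 ≤ K) (hM : K + 1 ≤ M) :
    (∀ᵐ G ∂(stdComplexGaussianMatrix M K), IsUnit (Gᴴ * G)) ∧
    ∀ k : Fin K,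
      ∫ G, ((Gᴴ * G)⁻¹ k k) ∂(stdComplexGaussianMatrix M K) = 1 / ((M : ℂ) - (K : ℂ)) := by
  have hme : MeasurableEmbedding (ofCols : (Fin K → (Fin M → ℂ)) → _) := by
    let e : (Fin K → (Fin M → ℂ)) ≃ᵐ Matrix (Fin M) (Fin K) ℂ :=
      { toFun := ofCols
        invFun := fun G j i => G i j
        left_inv := fun _ => rfl
        right_inv := fun _ => rfl
        measurable_toFun := measurable_pi_lambda _ fun i => measurable_pi_lambda _ fun j =>
          (measurable_pi_apply i).comp (measurable_pi_apply j)
        measurable_invFun := measurable_pi_lambda _ fun i => measurable_pi_lambda _ fun j =>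
          (measurable_pi_apply i).comp (measurable_pi_apply j) }
    exact e.measurableEmbedding
  rw [matrix_eq]
  constructor
  · rw [hme.ae_map_iff]
    filter_upwards [ae_li (M := M) K (by omega)] with c hc
    exact (isUnit_iff c).2 hc
  · intro k
    rw [hme.integral_map]
    have hre : ∀ c : Fin K → (Fin M → ℂ), ((ofCols c)ᴴ * ofCols c)⁻¹ k k
        = (((((ofCols c)ᴴ * ofCols c)⁻¹ k k).re : ℝ) : ℂ) := fun c =>
      Complex.ext rfl (by simpa using (diag_re k c).2)
    rw [integral_congr_ae (Filter.Eventually.of_forall hre)]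
    rw [integral_complex_ofReal, integral_eq_lintegral_of_nonneg_ae
      (Filter.Eventually.of_forall fun c => (diag_re k c).1)
      (Complex.measurable_re.comp (measurable_inv_diag k)).aestronglyMeasurable]
    obtain ⟨K, rfl⟩ : ∃ K', K = K' + 1 := ⟨K - 1, by omega⟩
    rw [lintegral_main (by omega) k, ENNReal.toReal_ofReal (by positivity),
      Nat.cast_sub (by omega)]
    simp
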